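/- arXiv:2605.01332 — 2 statements merged into one kernel-verified Lean document; each statement's English description precedes it below -/
import Mathlib

section
/- Let (W, S) be a Coxeter system and let w = s_{i_1} ⋯ s_{i_r} be a reduced expression in which the simple reflections s_{i_1}, …, s_{i_r} are pairwise distinct. Let A ⊆ {1,…,r} and j ∈ A. Then s_{i_j} is a right descent of w_A, i.e. ℓ(w_A s_{i_j}) < ℓ(w_A), if and only if s_{i_j} s_{i_k} = s_{i_k} s_{i_j} for every k ∈ A with k > j. -/
/-- Given a word `ω` and a set `A` of positions, the product of the letters of `ω`
at the positions in `A`, taken in increasing order. -/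
def CoxeterSystem.subwordProd {B W : Type*} [Group W] {M : CoxeterMatrix B}
    (cs : CoxeterSystem M W) (ω : List B) (A : Finset (Fin ω.length)) : W :=
  cs.wordProd ((A.sort (· ≤ ·)).map ω.get)

namespace CoxeterSystem

variable {B W : Type*} [Group W] {M : CoxeterMatrix B} (cs : CoxeterSystem M W)

open scoped Classical in
/-- The action of the simple reflection `s_i` on `W × ZMod 2`: conjugation on the first factor,
with a change of sign exactly at `s_i`. -/
noncomputable def signedConj (i : B) : Function.End (W × ZMod 2) :=
  fun p => (cs.simple i * p.1 * cs.simple i, p.2 + if p.1 = cs.simple i then 1 else 0)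

open scoped Classical in
theorem signedConj_mul_pow_apply (i j : B) (n : ℕ) (t : W) (e : ZMod 2) :
    ((cs.signedConj i * cs.signedConj j) ^ n) (t, e) =
      ((cs.simple i * cs.simple j) ^ n * t * ((cs.simple i * cs.simple j) ^ n)⁻¹,
        e + ∑ k ∈ Finset.range (2 * n),
          if cs.simple j * t = (cs.simple i * cs.simple j) ^ k then 1 else 0) := by
  induction n with
  | zero =>
    simp only [pow_zero, one_mul, inv_one, mul_one, mul_zero, Finset.range_zero,
      Finset.sum_empty, add_zero]
    rfl
  | succ n ih =>
    have hmul (f g : Function.End (W × ZMod 2)) (p : W × ZMod 2) : (f * g) p = f (g p) := rfl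
    rw [pow_succ', hmul, ih, hmul]
    set a := cs.simple i * cs.simple j with ha
    have hja : cs.simple j * a * cs.simple j = a⁻¹ := by simp [ha, mul_assoc]
    have hjan : ∀ n : ℕ, cs.simple j * a ^ n * cs.simple j = (a ^ n)⁻¹ := by
      intro n
      have h := conj_pow (a := cs.simple j) (b := a) (i := n)
      rw [cs.inv_simple, hja] at h
      rw [← h, inv_pow]
    have hjn : (a ^ n)⁻¹ * cs.simple j = cs.simple j * a ^ n := by
      rw [← hjan]; simp [mul_assoc]
    have h₁ : a ^ n * t * (a ^ n)⁻¹ = cs.simple j ↔ cs.simple j * t = a ^ (2 * n) := by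
      rw [mul_inv_eq_iff_eq_mul, ← eq_inv_mul_iff_mul_eq, ← mul_assoc, hjn, mul_assoc, ← pow_add,
        ← two_mul]
      constructor
      · intro h; rw [h]; simp
      · intro h; rw [← h]; simp
    have h₂ : cs.simple j * (a ^ n * t * (a ^ n)⁻¹) * cs.simple j = cs.simple i ↔
        cs.simple j * t = a ^ (2 * n + 1) := by
      have : cs.simple j * (a ^ n * t * (a ^ n)⁻¹) * cs.simple j =
          (a ^ n)⁻¹ * (cs.simple j * t) * (cs.simple j * a ^ n * cs.simple j) * cs.simple j
            * cs.simple j * cs.simple j := by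
        rw [hjan, ← mul_assoc ((a ^ n)⁻¹), hjn]
        simp [mul_assoc]
      rw [this, hjan]
      have hi : cs.simple i = a * cs.simple j := by simp [ha]
      rw [hi]
      simp only [simple_mul_simple_cancel_right, mul_left_inj]
      rw [mul_inv_eq_iff_eq_mul, inv_mul_eq_iff_eq_mul, ← pow_succ', ← pow_add]
      constructor <;> intro h <;> rw [h] <;> congr 1 <;> omega
    have e2 : 2 * (n + 1) = 2 * n + 1 + 1 := by ring
    simp only [signedConj, h₁, h₂, e2, Finset.sum_range_succ]
    refine Prod.ext ?_ ?_
    · simp only [ha, pow_succ', mul_inv_rev, inv_simple, mul_assoc]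
    · simp only [add_assoc]

theorem isLiftable_signedConj : M.IsLiftable cs.signedConj := by
  classical
  intro i j
  funext ⟨t, e⟩
  rw [signedConj_mul_pow_apply, two_mul, Finset.sum_range_add]
  simp only [pow_add, simple_mul_simple_pow, one_mul]
  simp only [inv_one, mul_one, CharTwo.add_self_eq_zero, add_zero]
  rfl

open scoped Classical in
theorem lift_signedConj_wordProd (ω : List B) (t : W) (e : ZMod 2) :
    cs.lift ⟨cs.signedConj, cs.isLiftable_signedConj⟩ (cs.wordProd ω) (t, e) =
      (cs.wordProd ω * t * (cs.wordProd ω)⁻¹, e + (cs.rightInvSeq ω).count t) := by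
  induction ω with
  | nil => simp; rfl
  | cons i ω ih =>
    have hmul (f g : Function.End (W × ZMod 2)) (p : W × ZMod 2) : (f * g) p = f (g p) := rfl
    rw [wordProd_cons, map_mul, hmul, ih, lift_apply_simple, signedConj, rightInvSeq]
    refine Prod.ext ?_ ?_
    · simp [mul_assoc]
    · have : cs.wordProd ω * t * (cs.wordProd ω)⁻¹ = cs.simple i ↔
          (cs.wordProd ω)⁻¹ * cs.simple i * cs.wordProd ω = t := by
        rw [mul_inv_eq_iff_eq_mul, mul_assoc, inv_mul_eq_iff_eq_mul, eq_comm]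
      simp [List.count_cons, this, add_assoc]

open scoped Classical in
/-- The parity of the multiplicity of `t` in the right inversion sequence of a word depends only
on the product of the word. -/
theorem count_rightInvSeq_eq_of_wordProd_eq {ω ω' : List B}
    (h : cs.wordProd ω = cs.wordProd ω') (t : W) :
    ((cs.rightInvSeq ω).count t : ZMod 2) = (cs.rightInvSeq ω').count t := by
  have h₁ := cs.lift_signedConj_wordProd ω t 0
  rw [h, lift_signedConj_wordProd] at h₁
  simpa using (congrArg Prod.snd h₁).symm

theorem simple_mem_rightInvSeq_of_isRightDescent {ω : List B} {i : B}
    (h : cs.IsRightDescent (cs.wordProd ω) i) : cs.simple i ∈ cs.rightInvSeq ω := by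
  classical
  obtain ⟨ω', hω', he⟩ := cs.exists_isReduced (cs.wordProd ω * cs.simple i)
  have hprod : cs.wordProd ω = cs.wordProd (ω'.concat i) := by
    rw [wordProd_concat, ← he, simple_mul_simple_cancel_right]
  have hnot : cs.simple i ∉ cs.rightInvSeq ω' := by
    intro hmem
    have := (cs.isRightInversion_of_mem_rightInvSeq hω' hmem).2
    rw [← he, simple_mul_simple_cancel_right] at this
    exact lt_asymm h this
  have hcount := cs.count_rightInvSeq_eq_of_wordProd_eq hprod (cs.simple i)
  have hnot' : cs.simple i ∉ (cs.rightInvSeq ω').map (MulAut.conj (cs.simple i)) := by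
    rw [List.mem_map]
    rintro ⟨x, hx, hxi⟩
    apply hnot
    have : x = cs.simple i := by
      rw [MulAut.conj_apply, inv_simple] at hxi
      have h2 := congrArg (fun y => cs.simple i * y * cs.simple i) hxi
      simpa [mul_assoc] using h2
    exact this ▸ hx
  rw [rightInvSeq_concat] at hcount
  simp only [List.concat_eq_append, List.count_append, List.count_eq_zero_of_not_mem hnot'] at hcount
  by_contra hmem
  rw [List.count_eq_zero_of_not_mem hmem] at hcount
  simp at hcount

theorem exists_of_mem_rightInvSeq {ω : List B} {t : W} (h : t ∈ cs.rightInvSeq ω) :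
    ∃ u k v, ω = u ++ k :: v ∧ t = (cs.wordProd v)⁻¹ * cs.simple k * cs.wordProd v := by
  induction ω with
  | nil => simp at h
  | cons i ω ih =>
    rw [rightInvSeq, List.mem_cons] at h
    rcases h with h | h
    · exact ⟨[], i, ω, rfl, h⟩
    · obtain ⟨u, k, v, rfl, ht⟩ := ih h
      exact ⟨i :: u, k, v, rfl, ht⟩

/-- The exchange property. -/
theorem exists_of_isRightDescent {ω : List B} {i : B}
    (h : cs.IsRightDescent (cs.wordProd ω) i) :
    ∃ u k v, ω = u ++ k :: v ∧
      cs.simple i = (cs.wordProd v)⁻¹ * cs.simple k * cs.wordProd v :=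
  cs.exists_of_mem_rightInvSeq (cs.simple_mem_rightInvSeq_of_isRightDescent h)

theorem exists_isReduced_subset (ω : List B) :
    ∃ ω', cs.IsReduced ω' ∧ cs.wordProd ω' = cs.wordProd ω ∧ ω' ⊆ ω := by
  induction ω using List.reverseRecOn with
  | nil => exact ⟨[], by simp [IsReduced], rfl, by simp⟩
  | append_singleton ω i ih =>
    obtain ⟨τ, hτ, hprod, hsub⟩ := ih
    by_cases hd : cs.IsRightDescent (cs.wordProd τ) i
    · obtain ⟨u, k, v, rfl, hi⟩ := cs.exists_of_isRightDescent hd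
      have hp : cs.wordProd (u ++ v) = cs.wordProd (ω ++ [i]) := by
        rw [wordProd_append, wordProd_append, ← hprod, wordProd_append, wordProd_cons,
          wordProd_singleton, hi]
        simp [mul_assoc]
      refine ⟨u ++ v, ?_, hp, ?_⟩
      · have h₁ := cs.isRightDescent_iff.1 hd
        rw [hτ.eq, hprod, ← cs.wordProd_singleton i, ← wordProd_append, ← hp] at h₁
        simp only [IsReduced, List.length_append, List.length_cons] at h₁ ⊢
        omega
      · intro x hx
        have := @hsub x
        simp only [List.mem_append, List.mem_cons] at this hx ⊢
        tauto
    · refine ⟨τ ++ [i], ?_, by simp [wordProd_append, hprod], ?_⟩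
      · have h₁ := cs.not_isRightDescent_iff.1 hd
        rw [IsReduced, wordProd_append, wordProd_singleton, h₁, hτ.eq]
        simp
      · intro x hx
        have := @hsub x
        simp only [List.mem_append] at hx ⊢
        tauto

theorem simple_mem_of_eq_wordProd {ω : List B} {i : B} (h : cs.simple i = cs.wordProd ω) :
    cs.simple i ∈ ω.map cs.simple := by
  obtain ⟨τ, hτ, hprod, hsub⟩ := cs.exists_isReduced_subset ω
  have hlen : τ.length = 1 := by rw [← hτ.eq, hprod, ← h, length_simple]
  obtain ⟨k, rfl⟩ := List.length_eq_one_iff.1 hlen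
  rw [wordProd_singleton, ← h] at hprod
  exact List.mem_map.2 ⟨k, hsub (by simp), hprod⟩

theorem isReduced_of_nodup_map_simple {ω : List B} (h : (ω.map cs.simple).Nodup) :
    cs.IsReduced ω := by
  induction ω using List.reverseRecOn with
  | nil => simp [IsReduced]
  | append_singleton ω i ih =>
    rw [List.map_append, List.nodup_append'] at h
    obtain ⟨hω, -, hdisj⟩ := h
    by_cases hd : cs.IsRightDescent (cs.wordProd ω) i
    · obtain ⟨u, k, v, rfl, hi⟩ := cs.exists_of_isRightDescent hd
      have hw : cs.simple i = cs.wordProd (v.reverse ++ k :: v) := by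
        rw [hi, wordProd_append, wordProd_reverse, wordProd_cons, mul_assoc]
      have hmem := cs.simple_mem_of_eq_wordProd hw
      refine absurd (by simp) (hdisj (a := cs.simple i) ?_)
      simp only [List.map_append, List.map_reverse, List.map_cons, List.mem_append,
        List.mem_reverse, List.mem_cons] at hmem ⊢
      tauto
    · rw [IsReduced, wordProd_append, wordProd_singleton, cs.not_isRightDescent_iff.1 hd,
        (ih hω).eq]
      simp

theorem commute_wordProd_of_isRightDescent {u v : List B} {i : B}
    (h : ((u ++ i :: v).map cs.simple).Nodup)
    (hd : cs.IsRightDescent (cs.wordProd (u ++ i :: v)) i) :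
    Commute (cs.simple i) (cs.wordProd v) := by
  obtain ⟨p, k, q, he, hi⟩ := cs.exists_of_isRightDescent hd
  have hmain (hik : i = k) (hvq : v = q) : Commute (cs.simple i) (cs.wordProd v) := by
    subst hik hvq
    rw [mul_assoc, eq_inv_mul_iff_mul_eq] at hi
    exact hi.symm
  rw [List.append_eq_append_iff] at he
  rcases he with ⟨c, rfl, hc⟩ | ⟨c, rfl, hc⟩
  · cases c with
    | nil =>
      rw [List.nil_append, List.cons.injEq] at hc
      exact hmain hc.1 hc.2
    | cons x c =>
      rw [List.cons_append, List.cons.injEq] at hc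
      obtain ⟨rfl, rfl⟩ := hc
      have hw : cs.simple i = cs.wordProd (q.reverse ++ k :: q) := by
        rw [hi, wordProd_append, wordProd_reverse, wordProd_cons, mul_assoc]
      have hmem := cs.simple_mem_of_eq_wordProd hw
      rw [List.map_append, List.nodup_append', List.map_cons, List.nodup_cons] at h
      refine absurd ?_ h.2.1.1
      simp only [List.map_append, List.map_reverse, List.map_cons, List.mem_append,
        List.mem_reverse, List.mem_cons] at hmem ⊢
      tauto
  · cases c with
    | nil =>
      rw [List.nil_append, List.cons.injEq] at hc
      exact hmain hc.1.symm hc.2.symm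
    | cons x c =>
      rw [List.cons_append, List.cons.injEq] at hc
      obtain ⟨rfl, rfl⟩ := hc
      set q := c ++ i :: v with hq
      have hw : cs.simple k = cs.wordProd (q ++ i :: q.reverse) := by
        rw [wordProd_append, wordProd_cons, wordProd_reverse, hi]
        simp [mul_assoc]
      have hmem := cs.simple_mem_of_eq_wordProd hw
      rw [List.append_assoc, List.cons_append, ← hq, List.map_append, List.nodup_append',
        List.map_cons, List.nodup_cons] at h
      refine absurd ?_ h.2.1.1
      have hiq : cs.simple i ∈ q.map cs.simple := List.mem_map_of_mem (by simp [hq])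
      simp only [List.map_append, List.map_reverse, List.map_cons, List.mem_append,
        List.mem_reverse, List.mem_cons] at hmem ⊢
      rcases hmem with hm | hm | hm
      · exact hm
      · rwa [hm]
      · exact hm

theorem commute_simple_of_commute_wordProd {v : List B} {i : B}
    (h : ((i :: v).map cs.simple).Nodup) (hc : Commute (cs.simple i) (cs.wordProd v)) :
    ∀ k ∈ v, Commute (cs.simple i) (cs.simple k) := by
  induction v using List.reverseRecOn with
  | nil => simp
  | append_singleton v k ih =>
    have hperm : (v ++ k :: [i]).Perm (i :: (v ++ [k])) := by
      simpa using List.perm_append_comm (l₁ := v ++ [k]) (l₂ := [i])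
    have hnd : ((v ++ k :: [i]).map cs.simple).Nodup :=
      (hperm.map cs.simple).nodup_iff.2 h
    have heq : cs.wordProd (v ++ k :: [i]) * cs.simple k = cs.wordProd (i :: v) := by
      have := hc.eq
      rw [wordProd_append, wordProd_singleton] at this
      rw [wordProd_append, wordProd_cons, wordProd_singleton, wordProd_cons,
        ← mul_assoc (cs.wordProd v), ← this]
      simp [mul_assoc]
    have hd : cs.IsRightDescent (cs.wordProd (v ++ k :: [i])) k := by
      rw [IsRightDescent, heq, (cs.isReduced_of_nodup_map_simple hnd).eq]
      refine (cs.length_wordProd_le _).trans_lt ?_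
      simp
    have hki : Commute (cs.simple i) (cs.simple k) := by
      simpa using (cs.commute_wordProd_of_isRightDescent hnd hd).symm
    have hcv : Commute (cs.simple i) (cs.wordProd v) := by
      have := hc.mul_right hki
      simpa [wordProd_append] using this
    have hsub : ((i :: v).map cs.simple).Nodup :=
      h.sublist (((List.sublist_append_left v [k]).cons_cons i).map cs.simple)
    intro x hx
    rcases List.mem_append.1 hx with hx | hx
    · exact ih hsub hcv x hx
    · rwa [List.mem_singleton.1 hx]

theorem isRightDescent_wordProd_iff_of_nodup {u v : List B} {i : B}
    (h : ((u ++ i :: v).map cs.simple).Nodup) :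
    cs.IsRightDescent (cs.wordProd (u ++ i :: v)) i ↔
      ∀ k ∈ v, Commute (cs.simple i) (cs.simple k) := by
  constructor
  · intro hd
    refine cs.commute_simple_of_commute_wordProd ?_ (cs.commute_wordProd_of_isRightDescent h hd)
    exact h.sublist ((List.sublist_append_right u (i :: v)).map cs.simple)
  · intro hc
    have hcv : Commute (cs.simple i) (cs.wordProd v) :=
      Commute.list_prod_right _ _ (by simpa using hc)
    have heq : cs.wordProd (u ++ i :: v) * cs.simple i = cs.wordProd (u ++ v) := by
      rw [wordProd_append, wordProd_cons, hcv.eq, wordProd_append]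
      simp [mul_assoc]
    rw [IsRightDescent, heq, (cs.isReduced_of_nodup_map_simple h).eq]
    refine (cs.length_wordProd_le _).trans_lt ?_
    simp

end CoxeterSystem

/-- Let `w = s_{i_1} ⋯ s_{i_r}` be a reduced expression with pairwise distinct
simple reflections, `A ⊆ {1,…,r}` and `j ∈ A`. Then `s_{i_j}` is a right descent of `w_A`
(i.e. `ℓ(w_A s_{i_j}) < ℓ(w_A)`) if and only if `s_{i_j}` commutes with `s_{i_k}` for every
`k ∈ A` with `k > j`. -/
theorem right_descent_subwordProd_iff {B W : Type*} [Group W] {M : CoxeterMatrix B}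
    (cs : CoxeterSystem M W) (ω : List B) (hred : cs.IsReduced ω)
    (hdist : (ω.map cs.simple).Nodup)
    (A : Finset (Fin ω.length)) (j : Fin ω.length) (hj : j ∈ A) :
    cs.length (cs.subwordProd ω A * cs.simple (ω.get j)) < cs.length (cs.subwordProd ω A) ↔
    ∀ k ∈ A, j < k →
      cs.simple (ω.get j) * cs.simple (ω.get k) =
        cs.simple (ω.get k) * cs.simple (ω.get j) := by
  obtain ⟨u, v, huv⟩ := List.append_of_mem ((Finset.mem_sort (· ≤ ·)).2 hj)
  have hlt : (u ++ j :: v).Pairwise (· < ·) := huv ▸ A.sortedLT_sort.pairwise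
  have hinj : Function.Injective fun k : Fin ω.length => cs.simple (ω.get k) := by
    intro a b hab
    have := List.nodup_iff_injective_get.1 hdist
      (a₁ := a.cast (List.length_map _).symm) (a₂ := b.cast (List.length_map _).symm)
      (by simpa using hab)
    simpa [Fin.ext_iff] using this
  have hnodup : ((u.map ω.get ++ ω.get j :: v.map ω.get).map cs.simple).Nodup := by
    have := List.Nodup.map hinj (hlt.imp fun h => h.ne)
    simpa [Function.comp_def] using this
  have hmem (k : Fin ω.length) : k ∈ v ↔ k ∈ A ∧ j < k := by
    rw [← Finset.mem_sort (· ≤ ·), huv]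
    rw [List.pairwise_append, List.pairwise_cons] at hlt
    constructor
    · intro hk
      exact ⟨by simp [hk], hlt.2.1.1 k hk⟩
    · rintro ⟨hk, hjk⟩
      rcases List.mem_append.1 hk with hk | hk
      · exact absurd hjk (hlt.2.2 k hk j (by simp)).asymm
      · exact (List.mem_cons.1 hk).resolve_left hjk.ne'
  have key := cs.isRightDescent_wordProd_iff_of_nodup hnodup
  have hsub : cs.subwordProd ω A = cs.wordProd (u.map ω.get ++ ω.get j :: v.map ω.get) := by
    rw [CoxeterSystem.subwordProd, huv, List.map_append, List.map_cons]
  rw [hsub]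
  refine key.trans ?_
  simp only [List.forall_mem_map, hmem, and_imp]
  rfl
end

section
/- Let (W, S) be a Coxeter system, S_P ⊆ S a subset, and let w = s_{i_1} ⋯ s_{i_r} be a reduced expression in which the simple reflections s_{i_1}, …, s_{i_r} are pairwise distinct. Then for every subset A ⊆ {1,…,r}, the element w_A belongs to W^P if and only if for every j ∈ A with s_{i_j} ∈ S_P there exists k ∈ A with k > j and s_{i_j} s_{i_k} ≠ s_{i_k} s_{i_j}. -/
/-- The set `W^P` of minimal length coset representatives attached to a subset `S_P` of the
simple reflections: `W^P = {v ∈ W : ℓ(v s) > ℓ(v) for every s ∈ S_P}`. -/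
def CoxeterSystem.minCosetReps {B W : Type*} [Group W] {M : CoxeterMatrix B}
    (cs : CoxeterSystem M W) (SP : Set B) : Set W :=
  {v | ∀ i ∈ SP, cs.length v < cs.length (v * cs.simple i)}

namespace CoxeterMatrix

variable {B : Type*} (M : CoxeterMatrix B)

/-- The functional `v ↦ 2 ⟨α_i, v⟩` on the geometric representation, where `⟨α_i, α_j⟩` is
`-cos (π / M i j)` (and `-1` if `M i j = 0`). -/
noncomputable def simpleCoroot (i : B) : Module.Dual ℝ (B →₀ ℝ) :=
  Finsupp.linearCombination ℝ fun j ↦ -2 * Real.cos (Real.pi / M i j)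

theorem simpleCoroot_single (i j : B) (r : ℝ) :
    M.simpleCoroot i (Finsupp.single j r) = r * (-2 * Real.cos (Real.pi / M i j)) := by
  simp [simpleCoroot]

theorem simpleCoroot_single_self (i : B) : M.simpleCoroot i (Finsupp.single i 1) = 2 := by
  simp [simpleCoroot_single]

theorem cos_nonneg {i j : B} (h : i ≠ j) : 0 ≤ Real.cos (Real.pi / M i j) := by
  have h1 := M.off_diagonal i j h
  rcases Nat.eq_zero_or_pos (M i j) with h0 | h0
  · simp [h0]
  · have h2 : (2 : ℝ) ≤ M i j := by exact_mod_cast (by omega : 2 ≤ M i j)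
    have := Real.pi_pos
    refine Real.cos_nonneg_of_neg_pi_div_two_le_of_le ?_ ?_
    · have : 0 ≤ Real.pi / M i j := by positivity
      linarith
    · gcongr

theorem cos_pos {i j : B} (h : i ≠ j) (h2 : M i j ≠ 2) :
    0 < Real.cos (Real.pi / M i j) := by
  have h1 := M.off_diagonal i j h
  rcases Nat.eq_zero_or_pos (M i j) with h0 | h0
  · simp [h0]
  · have h2 : (2 : ℝ) < M i j := by exact_mod_cast (by omega : 2 < M i j)
    have := Real.pi_pos
    refine Real.cos_pos_of_mem_Ioo ⟨?_, ?_⟩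
    · have : 0 ≤ Real.pi / M i j := by positivity
      linarith
    · gcongr

/-- A simple coroot is bounded above by each single term of its expansion on a nonnegative vector
supported away from the corresponding simple root. -/
theorem simpleCoroot_le {i : B} {v : B →₀ ℝ} (hv : ∀ k, 0 ≤ v k) (hi : v i = 0) (k : B) :
    M.simpleCoroot i v ≤ v k * (-2 * Real.cos (Real.pi / M i k)) := by
  classical
  have hterm (j : B) : v j * (-2 * Real.cos (Real.pi / M i j)) ≤ 0 := by
    by_cases hj : i = j
    · simp [← hj, hi]
    · have := mul_nonneg (hv j) (M.cos_nonneg hj)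
      linarith
  have hsum : M.simpleCoroot i v =
      ∑ j ∈ v.support, v j * (-2 * Real.cos (Real.pi / M i j)) := by
    simp [simpleCoroot, Finsupp.linearCombination_apply, Finsupp.sum]
  rw [hsum]
  by_cases hk : k ∈ v.support
  · rw [← Finset.add_sum_erase _ _ hk]
    linarith [Finset.sum_nonpos fun j (_ : j ∈ v.support.erase k) ↦ hterm j]
  · rw [Finsupp.notMem_support_iff.mp hk, zero_mul]
    exact Finset.sum_nonpos fun j _ ↦ hterm j

/-- The simple reflections of the geometric representation. -/
noncomputable def geomReflection (i : B) : (B →₀ ℝ) ≃ₗ[ℝ] (B →₀ ℝ) :=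
  Module.reflection (M.simpleCoroot_single_self i)

theorem geomReflection_apply (i : B) (v : B →₀ ℝ) :
    M.geomReflection i v = v - M.simpleCoroot i v • Finsupp.single i 1 :=
  Module.reflection_apply _ _

open Polynomial.Chebyshev in
theorem eval_S_two_mul_cos_of_three_le {m : ℕ} (hm : 3 ≤ m) :
    (S ℝ ((m - 2) / 2)).eval (2 * Real.cos (2 * Real.pi / m)) *
      ((S ℝ ((m - 1) / 2)).eval (2 * Real.cos (2 * Real.pi / m)) +
        (S ℝ ((m - 3) / 2)).eval (2 * Real.cos (2 * Real.pi / m))) = 0 ∧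
    (S ℝ ((m - 1) / 2)).eval (2 * Real.cos (2 * Real.pi / m)) *
      ((S ℝ (m / 2)).eval (2 * Real.cos (2 * Real.pi / m)) +
        (S ℝ ((m - 2) / 2)).eval (2 * Real.cos (2 * Real.pi / m))) = 0 := by
  set θ := 2 * Real.pi / m with hθ
  have hm3 : (3 : ℝ) ≤ m := by exact_mod_cast hm
  have hpi := Real.pi_pos
  have hmθ : m * θ = 2 * Real.pi := by rw [hθ]; field_simp
  have hsin : Real.sin θ ≠ 0 := by
    refine (Real.sin_pos_of_pos_of_lt_pi (by positivity) ?_).ne'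
    rw [hθ, div_lt_iff₀ (by linarith)]
    nlinarith
  have hS (k : ℤ) := S_two_mul_real_cos θ k
  obtain ⟨k, rfl | rfl⟩ := m.even_or_odd'
  · have h0 : (S ℝ ((k : ℤ) - 1)).eval (2 * Real.cos θ) = 0 := by
      refine (mul_eq_zero_iff_right hsin).mp ?_
      rw [hS]
      push_cast at hmθ ⊢
      rw [show ((k : ℝ) - 1 + 1) * θ = Real.pi by linarith, Real.sin_pi]
    have e1 : ((2 * k : ℕ) - 2 : ℤ) / 2 = k - 1 := by omega
    have e2 : ((2 * k : ℕ) - 1 : ℤ) / 2 = k - 1 := by omega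
    simp only [e1, e2, h0, zero_mul, and_self]
  · have h0 : (S ℝ (k : ℤ)).eval (2 * Real.cos θ) +
        (S ℝ ((k : ℤ) - 1)).eval (2 * Real.cos θ) = 0 := by
      refine (mul_eq_zero_iff_right hsin).mp ?_
      rw [add_mul, hS, hS]
      push_cast at hmθ ⊢
      rw [show ((k : ℝ) - 1 + 1) * θ = 2 * Real.pi - (k + 1) * θ by linarith,
        Real.sin_two_pi_sub]
      ring
    have e1 : ((2 * k + 1 : ℕ) - 1 : ℤ) / 2 = k := by omega
    have e2 : ((2 * k + 1 : ℕ) - 3 : ℤ) / 2 = k - 1 := by omega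
    have e3 : ((2 * k + 1 : ℕ) - 2 : ℤ) / 2 = k - 1 := by omega
    have e4 : ((2 * k + 1 : ℕ) : ℤ) / 2 = k := by omega
    simp only [e1, e2, e3, e4, h0, mul_zero, and_self]

theorem isLiftable_geomReflection : M.IsLiftable M.geomReflection := by
  intro i j
  have hsymm : M.simpleCoroot j (Finsupp.single i 1) = M.simpleCoroot i (Finsupp.single j 1) := by
    rw [simpleCoroot_single, simpleCoroot_single, M.symmetric]
  by_cases hij : i = j
  · subst hij
    ext1 v
    simp [geomReflection, Module.involutive_reflection _ v]
  rcases Nat.lt_or_ge (M i j) 3 with h3 | h3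
  · have h1 := M.off_diagonal i j hij
    obtain h0 | h2 : M i j = 0 ∨ M i j = 2 := by omega
    · simp [h0]
    · have hc : M.simpleCoroot i (Finsupp.single j 1) = 0 := by simp [simpleCoroot_single, h2]
      rw [h2]
      ext1 v
      simp only [pow_two, LinearEquiv.mul_apply, geomReflection_apply, map_sub, map_smul, hsymm,
        hc, simpleCoroot_single_self, LinearEquiv.coe_one, id_eq]
      module
  · refine LinearEquiv.ext fun v ↦ ?_
    have ht : 2 * Real.cos (2 * Real.pi / M i j) = M.simpleCoroot i (Finsupp.single j 1) *
        M.simpleCoroot j (Finsupp.single i 1) - 2 := by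
      rw [hsymm, simpleCoroot_single, mul_div_assoc, Real.cos_two_mul]
      ring
    obtain ⟨hS1, hS2⟩ := eval_S_two_mul_cos_of_three_le h3
    rw [geomReflection, geomReflection,
      Module.reflection_mul_reflection_pow_apply _ _ _ _ _ ht, hS1, hS2]
    simp

end CoxeterMatrix

namespace CoxeterSystem

variable {B W : Type*} [Group W] {M : CoxeterMatrix B} (cs : CoxeterSystem M W)

/-- The geometric representation of a Coxeter group. -/
noncomputable def geomRep : W →* ((B →₀ ℝ) ≃ₗ[ℝ] (B →₀ ℝ)) :=
  cs.lift ⟨M.geomReflection, M.isLiftable_geomReflection⟩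

theorem geomRep_simple_apply (i : B) (v : B →₀ ℝ) :
    cs.geomRep (cs.simple i) v = v - M.simpleCoroot i v • Finsupp.single i 1 := by
  rw [geomRep, lift_apply_simple, M.geomReflection_apply]

theorem geomRep_simple_apply_of_ne {i k : B} (h : i ≠ k) (v : B →₀ ℝ) :
    cs.geomRep (cs.simple i) v k = v k := by
  simp [geomRep_simple_apply, Finsupp.single_eq_of_ne' h]

theorem geomRep_simple_apply_single_self (i : B) :
    cs.geomRep (cs.simple i) (Finsupp.single i 1) = -Finsupp.single i 1 := by
  rw [geomRep_simple_apply, M.simpleCoroot_single_self]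
  module

theorem geomRep_wordProd_cons_apply (i : B) (ω : List B) (v : B →₀ ℝ) :
    cs.geomRep (cs.wordProd (i :: ω)) v =
      cs.geomRep (cs.simple i) (cs.geomRep (cs.wordProd ω) v) := by
  rw [wordProd_cons, map_mul, LinearEquiv.mul_apply]

theorem geomRep_wordProd_apply_of_notMem {i : B} {ω : List B} (h : i ∉ ω) (v : B →₀ ℝ) :
    cs.geomRep (cs.wordProd ω) v i = v i := by
  induction ω with
  | nil => simp
  | cons j ω ih =>
    rw [List.mem_cons, not_or] at h
    rw [geomRep_wordProd_cons_apply, geomRep_simple_apply_of_ne _ (Ne.symm h.1), ih h.2]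

theorem geomRep_wordProd_single_nonneg {i : B} {ω : List B} (h : (i :: ω).Nodup) (k : B) :
    0 ≤ cs.geomRep (cs.wordProd ω) (Finsupp.single i 1) k := by
  classical
  induction ω generalizing k with
  | nil => simp [Finsupp.single_apply]; split_ifs <;> simp
  | cons j ω ih =>
    have hij : i ≠ j := by grind
    have hj : j ∉ ω := by grind
    have ih := ih (by grind)
    have hvj : cs.geomRep (cs.wordProd ω) (Finsupp.single i 1) j = 0 := by
      simp [cs.geomRep_wordProd_apply_of_notMem hj, Finsupp.single_eq_of_ne' hij]
    by_cases hk : j = k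
    · subst hk
      have := M.simpleCoroot_le ih hvj j
      simp [geomRep_wordProd_cons_apply, geomRep_simple_apply, hvj] at this ⊢
      linarith
    · rw [geomRep_wordProd_cons_apply, geomRep_simple_apply_of_ne _ hk]
      exact ih k

theorem geomRep_wordProd_single_pos {i k : B} {ω : List B} (h : (i :: ω).Nodup) (hk : k ∈ ω)
    (hM : M i k ≠ 2) : 0 < cs.geomRep (cs.wordProd ω) (Finsupp.single i 1) k := by
  induction ω with
  | nil => simp at hk
  | cons j ω ih =>
    have hij : i ≠ j := by grind
    have hj : j ∉ ω := by grind
    have hω : (i :: ω).Nodup := by grind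
    rw [geomRep_wordProd_cons_apply]
    by_cases hjk : j = k
    · subst hjk
      have hvj : cs.geomRep (cs.wordProd ω) (Finsupp.single i 1) j = 0 := by
        simp [cs.geomRep_wordProd_apply_of_notMem hj, Finsupp.single_eq_of_ne' hij]
      have hvi : cs.geomRep (cs.wordProd ω) (Finsupp.single i 1) i = 1 := by
        simp [cs.geomRep_wordProd_apply_of_notMem (List.nodup_cons.mp hω).1]
      have := M.simpleCoroot_le (cs.geomRep_wordProd_single_nonneg hω) hvj i
      have hpos := M.cos_pos hij hM
      rw [hvi, M.symmetric] at this
      simp [geomRep_simple_apply, hvj]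
      linarith
    · rw [geomRep_simple_apply_of_ne _ hjk]
      exact ih hω (by grind)

/-- Every word representing the product of a word with distinct letters uses all those letters. -/
theorem subset_of_wordProd_eq {ω ω' : List B} (hω : ω.Nodup)
    (h : cs.wordProd ω = cs.wordProd ω') : ω ⊆ ω' := by
  intro i hi
  by_contra hi'
  obtain ⟨a, b, rfl⟩ := List.append_of_mem hi
  have ha : i ∉ a := by grind
  have hb : i ∉ b.reverse := by grind
  have hinv : cs.geomRep (cs.wordProd b)
      (cs.geomRep (cs.wordProd b.reverse) (Finsupp.single i 1)) = Finsupp.single i 1 := by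
    rw [← LinearEquiv.mul_apply, ← map_mul, wordProd_reverse]
    simp
  have key := congrArg
    (fun w ↦ cs.geomRep w (cs.geomRep (cs.wordProd b.reverse) (Finsupp.single i 1)) i) h
  simp only [cs.geomRep_wordProd_apply_of_notMem hi', cs.geomRep_wordProd_apply_of_notMem hb,
    wordProd_append, map_mul, LinearEquiv.mul_apply, cs.geomRep_wordProd_apply_of_notMem ha,
    geomRep_wordProd_cons_apply, hinv, geomRep_simple_apply_single_self] at key
  norm_num at key

/-- A word with distinct letters is reduced. -/
theorem isReduced_of_nodup {ω : List B} (hω : ω.Nodup) : cs.IsReduced ω := by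
  obtain ⟨ω', hω', h⟩ := cs.exists_isReduced (cs.wordProd ω)
  refine le_antisymm (cs.length_wordProd_le ω) ?_
  rw [h, hω'.eq]
  exact (hω.subperm (cs.subset_of_wordProd_eq hω h)).length_le

theorem commute_simple_of_eq_two {i k : B} (h : M i k = 2) :
    cs.simple i * cs.simple k = cs.simple k * cs.simple i := by
  have h2 := cs.simple_mul_simple_pow i k
  rw [h, pow_two] at h2
  simpa using eq_inv_of_mul_eq_one_left h2

/-- Conjugating by `s_i` a product of distinct simple reflections other than `s_i`, not all
commuting with `s_i`, leaves the parabolic subgroup generated by the simple reflections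
other than `s_i`. -/
theorem simple_mul_wordProd_mul_simple_ne {i k : B} {ω ω' : List B} (h : (i :: ω).Nodup)
    (hk : k ∈ ω) (hik : cs.simple i * cs.simple k ≠ cs.simple k * cs.simple i) (hi : i ∉ ω') :
    cs.simple i * cs.wordProd ω * cs.simple i ≠ cs.wordProd ω' := by
  intro heq
  have hM : M i k ≠ 2 := mt cs.commute_simple_of_eq_two hik
  have hne : i ≠ k := by grind
  set v := cs.geomRep (cs.wordProd ω) (Finsupp.single i 1) with hv
  have hvi : v i = 1 := by
    simp [hv, cs.geomRep_wordProd_apply_of_notMem (List.nodup_cons.mp h).1]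
  have hcoroot : M.simpleCoroot i v = 2 := by
    have key := congrArg (fun w ↦ cs.geomRep w (Finsupp.single i 1) i) heq
    simp only [map_mul, LinearEquiv.mul_apply, geomRep_simple_apply_single_self, map_neg, ← hv,
      cs.geomRep_wordProd_apply_of_notMem hi] at key
    simp only [geomRep_simple_apply, Finsupp.neg_apply, Finsupp.sub_apply, Finsupp.smul_apply,
      Finsupp.single_eq_same, hvi, smul_eq_mul] at key
    linarith
  have hsplit : Finsupp.single i 1 + v.erase i = v := by
    rw [← hvi]
    exact Finsupp.single_add_erase i v
  have hzero : M.simpleCoroot i (v.erase i) = 0 := by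
    rw [← hsplit, map_add, M.simpleCoroot_single_self] at hcoroot
    linarith
  have hnonneg (j : B) : 0 ≤ v.erase i j := by
    by_cases hj : j = i
    · simp [hj]
    · rw [Finsupp.erase_ne hj]
      exact cs.geomRep_wordProd_single_nonneg h j
  have hle := M.simpleCoroot_le hnonneg (Finsupp.erase_same) k
  rw [hzero, Finsupp.erase_ne hne.symm] at hle
  have := mul_pos (cs.geomRep_wordProd_single_pos h hk hM) (M.cos_pos hne hM)
  linarith

/-- A letter of a word with distinct letters is a right ascent of the product exactly when it fails
to commute with some later letter. -/
theorem length_lt_length_mul_simple_iff {a b : List B} {i : B} (h : (a ++ i :: b).Nodup) :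
    cs.length (cs.wordProd (a ++ i :: b)) <
        cs.length (cs.wordProd (a ++ i :: b) * cs.simple i) ↔
      ∃ k ∈ b, cs.simple i * cs.simple k ≠ cs.simple k * cs.simple i := by
  constructor
  · contrapose!
    intro hcomm
    have hb : Commute (cs.simple i) (cs.wordProd b) := by
      refine Commute.list_prod_right _ _ fun x hx ↦ ?_
      obtain ⟨k, hk, rfl⟩ := List.mem_map.mp hx
      exact hcomm k hk
    have heq : cs.wordProd (a ++ i :: b) * cs.simple i = cs.wordProd (a ++ b) := by
      rw [wordProd_append, wordProd_cons, hb.eq, wordProd_append]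
      simp [mul_assoc]
    rw [heq, (cs.isReduced_of_nodup h).eq]
    exact (cs.length_wordProd_le _).trans (by simp)
  · rintro ⟨k, hk, hik⟩
    by_contra hlt
    have hlt := lt_of_le_of_ne (not_lt.mp hlt) (cs.length_mul_simple_ne _ i)
    obtain ⟨ω', hω', heq⟩ := cs.exists_isReduced (cs.wordProd (a ++ i :: b) * cs.simple i)
    rw [heq, hω'.eq, (cs.isReduced_of_nodup h).eq] at hlt
    have hsub : a ++ i :: b ⊆ ω' ++ [i] := by
      refine cs.subset_of_wordProd_eq h ?_
      rw [cs.wordProd_append ω', ← heq]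
      simp
    have hi : i ∉ ω' := fun hi ↦ by
      have hsub' : a ++ i :: b ⊆ ω' := fun x hx ↦ by
        have := hsub hx
        grind
      exact hlt.not_ge (h.subperm hsub').length_le
    refine cs.simple_mul_wordProd_mul_simple_ne (ω := b) (ω' := a.reverse ++ ω') (i := i)
      (by grind) hk hik (by grind) ?_
    rw [wordProd_append, wordProd_reverse, ← heq, wordProd_append, wordProd_cons]
    group

end CoxeterSystem

/-- Let `w = s_{i_1} ⋯ s_{i_r}` be a reduced expression with pairwise distinct
simple reflections and `S_P ⊆ S`. Then for every `A ⊆ {1,…,r}`, `w_A ∈ W^P` if and only if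
for every `j ∈ A` with `s_{i_j} ∈ S_P` there exists `k ∈ A` with `k > j` and
`s_{i_j} s_{i_k} ≠ s_{i_k} s_{i_j}`. -/
theorem subwordProd_mem_minCosetReps_iff {B W : Type*} [Group W] {M : CoxeterMatrix B}
    (cs : CoxeterSystem M W) (SP : Set B) (ω : List B) (hred : cs.IsReduced ω)
    (hdist : (ω.map cs.simple).Nodup) (A : Finset (Fin ω.length)) :
    cs.subwordProd ω A ∈ cs.minCosetReps SP ↔
    ∀ j ∈ A, ω.get j ∈ SP →
      ∃ k ∈ A, j < k ∧
        cs.simple (ω.get j) * cs.simple (ω.get k) ≠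
          cs.simple (ω.get k) * cs.simple (ω.get j) := by
  have hω : ω.Nodup := hdist.of_map _
  have hnodup : ((A.sort (· ≤ ·)).map ω.get).Nodup :=
    (A.sort_nodup _).map hω.injective_get
  have hsplit (j : Fin ω.length) (hj : j ∈ A) :
      cs.length (cs.subwordProd ω A) < cs.length (cs.subwordProd ω A * cs.simple (ω.get j)) ↔
        ∃ k ∈ A, j < k ∧ cs.simple (ω.get j) * cs.simple (ω.get k) ≠
          cs.simple (ω.get k) * cs.simple (ω.get j) := by
    obtain ⟨a, b, hab⟩ := List.append_of_mem ((A.mem_sort (· ≤ ·)).mpr hj)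
    have hmem (k : Fin ω.length) : k ∈ b ↔ k ∈ A ∧ j < k := by
      have hsorted := A.sortedLT_sort.pairwise
      rw [← A.mem_sort (· ≤ ·)]
      rw [hab, List.pairwise_append, List.pairwise_cons] at hsorted
      rw [hab, List.mem_append, List.mem_cons]
      have hlt := hsorted.2.1.1 k
      have hgt (hk : k ∈ a) := hsorted.2.2 k hk j List.mem_cons_self
      constructor
      · exact fun hk ↦ ⟨.inr (.inr hk), hlt hk⟩
      · rintro ⟨hk | rfl | hk, hjk⟩
        · exact absurd hjk (hgt hk).not_gt
        · exact absurd hjk (lt_irrefl _)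
        · exact hk
    rw [hab, List.map_append, List.map_cons] at hnodup
    rw [CoxeterSystem.subwordProd, hab, List.map_append, List.map_cons,
      cs.length_lt_length_mul_simple_iff hnodup]
    simp [hmem, and_assoc]
  constructor
  · exact fun h j hj hP ↦ (hsplit j hj).mp (h _ hP)
  · intro h i hi
    by_cases hmem : i ∈ (A.sort (· ≤ ·)).map ω.get
    · obtain ⟨j, hj, rfl⟩ := List.mem_map.mp hmem
      have hj := (A.mem_sort _).mp hj
      exact (hsplit j hj).mpr (h j hj hi)
    · have hconcat : ((A.sort (· ≤ ·)).map ω.get ++ [i]).Nodup := by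
        rw [List.nodup_append]
        grind
      have hlen := (cs.isReduced_of_nodup hconcat).eq
      rw [cs.wordProd_append, cs.wordProd_singleton] at hlen
      rw [CoxeterSystem.subwordProd, hlen, (cs.isReduced_of_nodup hnodup).eq]
      simp
end
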